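/- Every chainable continuum has exactly 2^{ℵ₀} meager composants. -/

import Mathlib

open Set Topology

/-- The meager composant of `x`: the union of all nowhere dense subcontinua containing `x`. -/
def MeagerComposant (X : Type) [TopologicalSpace X] (x : X) : Set X :=
  ⋃₀ {L : Set X | IsCompact L ∧ IsConnected L ∧ IsNowhereDense L ∧ x ∈ L}

/-- A continuum is hereditarily unicoherent if the intersection of any two subcontinua
is connected (possibly empty, hence preconnected). -/
def HereditarilyUnicoherent (X : Type) [TopologicalSpace X] : Prop :=
  ∀ A B : Set X, IsCompact A → IsConnected A → IsCompact B → IsConnected B →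
    IsPreconnected (A ∩ B)

/-- A subcontinuum `A` of `X` is ample if every open neighborhood of `A` contains a
subcontinuum having `A` in its interior. -/
def Ample {X : Type} [TopologicalSpace X] (A : Set X) : Prop :=
  ∀ U : Set X, IsOpen U → A ⊆ U →
    ∃ K : Set X, IsCompact K ∧ IsPreconnected K ∧ A ⊆ interior K ∧ K ⊆ U

/-- A set `C` is indecomposable if it is not the union of two proper subcontinua. -/
def IndecomposableSet {X : Type} [TopologicalSpace X] (C : Set X) : Prop :=
  ¬ ∃ H K : Set X, IsCompact H ∧ IsConnected H ∧ IsCompact K ∧ IsConnected K ∧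
    H ⊆ C ∧ K ⊆ C ∧ H ≠ C ∧ K ≠ C ∧ H ∪ K = C

/-- `X` is chainable: for every `ε > 0` there is an `ε`-chain cover of `X`. -/
def Chainable (X : Type) [MetricSpace X] : Prop :=
  ∀ ε : ℝ, 0 < ε → ∃ (n : ℕ) (U : Fin n → Set X),
    (∀ i, IsOpen (U i)) ∧ (⋃ i, U i) = Set.univ ∧ (∀ i, Metric.diam (U i) < ε) ∧
    ∀ i j : Fin n, (U i ∩ U j).Nonempty ↔ ((i : ℕ) ≤ (j : ℕ) + 1 ∧ (j : ℕ) ≤ (i : ℕ) + 1)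

set_option linter.unusedSectionVars false

section Order
variable {X : Type} [MetricSpace X] [CompactSpace X]

lemma chain_rel_exists (hX : Chainable X) : ∃ r : X → X → Prop, (∀ x y, r x y ∨ r y x) ∧
    (∀ x y z, r x y → r y z → r x z) ∧
    (∀ L : Set X, IsClosed L → IsPreconnected L → ∀ x y z, x ∈ L → z ∈ L → r x y → r y z → y ∈ L) := by
  have h1 : ∀ k : ℕ, ∃ (n : ℕ) (U : Fin n → Set X),
    (∀ i, IsOpen (U i)) ∧ (⋃ i, U i) = Set.univ ∧ (∀ i, Metric.diam (U i) < 1 / ((k : ℝ) + 1)) ∧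
    ∀ i j : Fin n, (U i ∩ U j).Nonempty ↔ ((i : ℕ) ≤ (j : ℕ) + 1 ∧ (j : ℕ) ≤ (i : ℕ) + 1) :=
    fun k => hX _ (by positivity)
  choose n U hO hC hD hI using h1
  have h2 : ∀ k (x : X), ∃ i : Fin (n k), x ∈ U k i := fun k x => by
    have : x ∈ ⋃ i, U k i := by rw [hC]; trivial
    simpa using this
  choose pos hpos using h2
  let F : Ultrafilter ℕ := Filter.hyperfilter ℕ
  refine ⟨fun x y => ∀ᶠ k in (F : Filter ℕ), (pos k x : ℕ) ≤ pos k y, ?_, ?_, ?_⟩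
  · intro x y
    rw [← Ultrafilter.eventually_or]
    exact Filter.Eventually.of_forall fun k => le_total _ _
  · intro x y z h h'
    filter_upwards [h, h'] with k a b using a.trans b
  · intro L hL hLc x y z hx hz hxy hyz
    rw [← hL.closure_eq, Metric.mem_closure_iff]
    intro ε hε
    have h3 : ∀ᶠ k : ℕ in (F : Filter ℕ), 1 / ((k : ℝ) + 1) < ε := by
      have h4 : ∀ᶠ k : ℕ in Filter.atTop, 1 / ((k : ℝ) + 1) < ε :=
        (tendsto_order.1 (tendsto_one_div_add_atTop_nhds_zero_nat (𝕜 := ℝ))).2 ε hε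
      exact (Nat.hyperfilter_le_atTop) h4
    obtain ⟨k, hk1, hk2, hk3⟩ := (hxy.and (hyz.and h3)).exists
    have hne : (L ∩ U k (pos k y)).Nonempty := by
      by_contra hne
      rw [Set.not_nonempty_iff_eq_empty] at hne
      have hnot : ∀ w ∈ L, w ∉ U k (pos k y) := fun w hw hw' => by
        have : w ∈ L ∩ U k (pos k y) := ⟨hw, hw'⟩
        rw [hne] at this; exact this
      let P : Set X := ⋃ i : {i : Fin (n k) // (i : ℕ) < pos k y}, U k i
      let Q : Set X := ⋃ i : {i : Fin (n k) // (pos k y : ℕ) < i}, U k i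
      have hP : IsOpen P := isOpen_iUnion fun i => hO k _
      have hQ : IsOpen Q := isOpen_iUnion fun i => hO k _
      have hdisj : Disjoint P Q := by
        rw [Set.disjoint_left]
        intro w hw hw'
        simp only [P, Q, Set.mem_iUnion] at hw hw'
        obtain ⟨i, hi⟩ := hw
        obtain ⟨j, hj⟩ := hw'
        have := (hI k i.1 j.1).1 ⟨w, hi, hj⟩
        have := i.2
        have := j.2
        omega
      have hcov : L ⊆ P ∪ Q := by
        intro w hw
        rcases lt_trichotomy (pos k w : ℕ) (pos k y) with h | h | h
        · left; exact Set.mem_iUnion.2 ⟨⟨pos k w, h⟩, hpos k w⟩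
        · exfalso; apply hnot w hw; rw [← Fin.ext h]; exact hpos k w
        · right; exact Set.mem_iUnion.2 ⟨⟨pos k w, h⟩, hpos k w⟩
      have hxP : x ∈ P := by
        refine Set.mem_iUnion.2 ⟨⟨pos k x, lt_of_le_of_ne hk1 fun h => ?_⟩, hpos k x⟩
        apply hnot x hx; rw [← Fin.ext h]; exact hpos k x
      have hzQ : z ∈ Q := by
        refine Set.mem_iUnion.2 ⟨⟨pos k z, lt_of_le_of_ne hk2 fun h => ?_⟩, hpos k z⟩
        apply hnot z hz; rw [Fin.ext h]; exact hpos k z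
      have := hLc.subset_left_of_subset_union hP hQ hdisj hcov ⟨x, hx, hxP⟩ hz
      exact Set.disjoint_left.1 hdisj this hzQ
    obtain ⟨w, hw, hw'⟩ := hne
    refine ⟨w, hw, ?_⟩
    have hb : Bornology.IsBounded (U k (pos k y)) := (isCompact_univ.isBounded).subset (Set.subset_univ _)
    linarith [Metric.dist_le_diam_of_mem hb (hpos k y) hw', hD k (pos k y)]

lemma chain_order_exists (hX : Chainable X) : ∃ _ : LinearOrder X,
    ∀ L : Set X, IsClosed L → IsPreconnected L → ∀ x y z, x ∈ L → z ∈ L → x ≤ y → y ≤ z → y ∈ L := by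
  classical
  obtain ⟨r, htot, htr, hcv⟩ := chain_rel_exists hX
  exact ⟨{ le := r
           le_refl := fun x => by simpa using htot x x
           le_trans := htr
           le_antisymm := fun x y h h' => by
            have := hcv {x} isClosed_singleton isPreconnected_singleton x y x rfl rfl h h'
            exact this.symm
           le_total := htot
           toDecidableLE := Classical.decRel _ }, hcv⟩
end Order

section Conn
variable {X : Type} [TopologicalSpace X] [ConnectedSpace X]

lemma not_preconn_open {O : Set X} (hO : IsOpen O) (h : ¬ IsPreconnected O) :
    ∃ P Q : Set X, IsOpen P ∧ IsOpen Q ∧ P.Nonempty ∧ Q.Nonempty ∧ Disjoint P Q ∧ P ∪ Q = O := by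
  unfold IsPreconnected at h
  push Not at h
  obtain ⟨u, v, hu, hv, hc, hn1, hn2, he⟩ := h
  refine ⟨O ∩ u, O ∩ v, hO.inter hu, hO.inter hv, hn1, hn2, ?_, ?_⟩
  · rw [Set.disjoint_left]
    rintro x ⟨a, b⟩ ⟨_, c⟩
    have : x ∈ O ∩ (u ∩ v) := ⟨a, b, c⟩
    rw [he] at this; exact this
  · rw [← Set.inter_union_distrib_left]; exact Set.inter_eq_left.2 hc

lemma closed_of_split {K P Q : Set X} (hQ : IsOpen Q) (hd : Disjoint P Q)
    (hPQ : P ∪ Q = Kᶜ) : IsClosed (K ∪ P) := by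
  have : K ∪ P = Qᶜ := by
    ext x
    have h1 : x ∈ P ∪ Q ↔ x ∈ Kᶜ := by rw [hPQ]
    have h2 := fun a b => Set.disjoint_left.1 hd (show x ∈ P from a) (show x ∈ Q from b)
    simp only [Set.mem_union, Set.mem_compl_iff] at *
    tauto
  rw [this]; exact hQ.isClosed_compl

lemma union_split_conn {K P Q : Set X} (hK : IsClosed K) (hKc : IsPreconnected K) (hne : K.Nonempty)
    (hP : IsOpen P) (hQ : IsOpen Q) (hd : Disjoint P Q) (hPQ : P ∪ Q = Kᶜ) :
    IsPreconnected (K ∪ P) := by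
  have hcl := closed_of_split hQ hd hPQ
  have hcl' : IsClosed (K ∪ Q) := closed_of_split hP hd.symm (by rw [Set.union_comm]; exact hPQ)
  rw [isPreconnected_iff_subset_of_fully_disjoint_closed hcl]
  have key : ∀ u v : Set X, IsClosed u → IsClosed v → K ∪ P ⊆ u ∪ v → Disjoint u v → K ⊆ u →
      K ∪ P ⊆ u := by
    intro u v hu hv hc huv hKu
    have hclop : IsClopen (v ∩ (K ∪ P)) := by
      refine ⟨hv.inter hcl, ?_⟩
      have : v ∩ (K ∪ P) = ((u ∩ (K ∪ P)) ∪ (K ∪ Q))ᶜ := by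
        ext x
        have h1 : x ∈ P ∪ Q ↔ x ∈ Kᶜ := by rw [hPQ]
        have h2 := fun a b => Set.disjoint_left.1 hd (show x ∈ P from a) (show x ∈ Q from b)
        have h3 := fun a b => Set.disjoint_left.1 huv (show x ∈ u from a) (show x ∈ v from b)
        have h4 := @hc x
        have h5 := @hKu x
        simp only [Set.mem_union, Set.mem_compl_iff, Set.mem_inter_iff] at *
        tauto
      rw [this]
      exact ((hu.inter hcl).union hcl').isOpen_compl
    rcases isClopen_iff.1 hclop with h | h
    · intro x hx
      rcases hc hx with h' | h'
      · exact h'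
      · have : x ∈ v ∩ (K ∪ P) := ⟨h', hx⟩
        rw [h] at this; exact this.elim
    · obtain ⟨x, hx⟩ := hne
      have : x ∈ v ∩ (K ∪ P) := by rw [h]; trivial
      exact (Set.disjoint_left.1 huv (hKu hx) this.1).elim
  intro u v hu hv hc huv
  have hKs := (isPreconnected_iff_subset_of_fully_disjoint_closed hK).1 hKc u v hu hv
    (subset_union_left.trans hc) huv
  rcases hKs with h | h
  · exact Or.inl (key u v hu hv hc huv h)
  · exact Or.inr (key v u hv hu (by rwa [Set.union_comm v u]) huv.symm h)

/-- Two closed sets covering a connected space meet. -/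
lemma cover_meet {S T : Set X} (hS : IsClosed S) (hT : IsClosed T) (h : S ∪ T = Set.univ)
    (hSn : S.Nonempty) (hTn : T.Nonempty) : (S ∩ T).Nonempty := by
  have := isPreconnected_closed_iff.1 (isPreconnected_univ (α := X)) S T hS hT (by rw [h])
    (by simpa) (by simpa)
  simpa using this

end Conn

section Irred

lemma compIn_closed {X : Type} [TopologicalSpace X] {F : Set X} (hF : IsClosed F) (x : X) :
    IsClosed (connectedComponentIn F x) := by
  by_cases hx : x ∈ F
  · refine isClosed_of_closure_subset ?_
    exact isPreconnected_connectedComponentIn.closure.subset_connectedComponentIn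
      (subset_closure (mem_connectedComponentIn hx))
      (closure_minimal (connectedComponentIn_subset F x) hF)
  · rw [connectedComponentIn_eq_empty hx]; exact isClosed_empty

variable {X : Type} [MetricSpace X] [CompactSpace X] [ConnectedSpace X]

/-- closed connected sets are convex with respect to the linear order -/
def ConvexOrd (X : Type) [TopologicalSpace X] [LinearOrder X] : Prop :=
  ∀ L : Set X, IsClosed L → IsPreconnected L → ∀ x y z, x ∈ L → z ∈ L → x ≤ y → y ≤ z → y ∈ L

lemma no_three_aux [LinearOrder X] (hcv : ConvexOrd X) {C P Q R : Set X} (hC : IsClosed C)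
    (hCc : IsPreconnected C) (hCn : C.Nonempty) (hP : IsOpen P) (hQ : IsOpen Q) (hR : IsOpen R)
    (hPQ : Disjoint P Q) (hQR : Disjoint Q R) (h : P ∪ Q ∪ R = Cᶜ) {x y z : X}
    (hx : x ∈ P) (hy : y ∈ Q) (hz : z ∈ R) (hxy : x ≤ y) (hyz : y ≤ z) : False := by
  have hd : Disjoint (P ∪ R) Q := Set.disjoint_union_left.2 ⟨hPQ, hQR.symm⟩
  have he : (P ∪ R) ∪ Q = Cᶜ := by rw [← h, Set.union_assoc, Set.union_comm R Q, ← Set.union_assoc]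
  have h1 := union_split_conn hC hCc hCn (hP.union hR) hQ hd he
  have h2 := closed_of_split hQ hd he
  have h3 := hcv _ h2 h1 x y z (Or.inr (Or.inl hx)) (Or.inr (Or.inr hz)) hxy hyz
  rcases h3 with h3 | h3
  · have : y ∈ Cᶜ := by rw [← h]; exact Or.inl (Or.inr hy)
    exact this h3
  · exact Set.disjoint_left.1 hd h3 hy

lemma no_three [LinearOrder X] (hcv : ConvexOrd X) {C P Q R : Set X} (hC : IsClosed C)
    (hCc : IsPreconnected C) (hCn : C.Nonempty) (hP : IsOpen P) (hQ : IsOpen Q) (hR : IsOpen R)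
    (hPQ : Disjoint P Q) (hQR : Disjoint Q R) (hPR : Disjoint P R) (h : P ∪ Q ∪ R = Cᶜ)
    (hPn : P.Nonempty) (hQn : Q.Nonempty) (hRn : R.Nonempty) : False := by
  obtain ⟨x, hx⟩ := hPn
  obtain ⟨y, hy⟩ := hQn
  obtain ⟨z, hz⟩ := hRn
  have e1 : P ∪ R ∪ Q = Cᶜ := by rw [← h]; ext; simp; tauto
  have e2 : Q ∪ P ∪ R = Cᶜ := by rw [← h]; ext; simp; tauto
  have e3 : Q ∪ R ∪ P = Cᶜ := by rw [← h]; ext; simp; tauto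
  have e4 : R ∪ P ∪ Q = Cᶜ := by rw [← h]; ext; simp; tauto
  have e5 : R ∪ Q ∪ P = Cᶜ := by rw [← h]; ext; simp; tauto
  rcases le_total x y with a | a <;> rcases le_total y z with b | b <;> rcases le_total x z with c | c
  · exact no_three_aux hcv hC hCc hCn hP hQ hR hPQ hQR h hx hy hz a b
  · exact no_three_aux hcv hC hCc hCn hP hQ hR hPQ hQR h hx hy hz a b
  · exact no_three_aux hcv hC hCc hCn hP hR hQ hPR hQR.symm e1 hx hz hy c b
  · exact no_three_aux hcv hC hCc hCn hR hP hQ hPR.symm hPQ e4 hz hx hy c a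
  · exact no_three_aux hcv hC hCc hCn hQ hP hR hPQ.symm hPR e2 hy hx hz a c
  · exact no_three_aux hcv hC hCc hCn hQ hR hP hQR hPR.symm e3 hy hz hx b c
  · exact no_three_aux hcv hC hCc hCn hR hQ hP hQR.symm hPQ.symm e5 hz hy hx b a
  · exact no_three_aux hcv hC hCc hCn hR hQ hP hQR.symm hPQ.symm e5 hz hy hx b a

lemma split_ext [LinearOrder X] (hcv : ConvexOrd X) {C : Set X} (hC : IsClosed C)
    (hCc : IsPreconnected C) (hCn : C.Nonempty) (hne : Cᶜ.Nonempty) :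
    ∃ D, C ⊆ D ∧ IsClosed D ∧ IsPreconnected D ∧ Dᶜ.Nonempty ∧ IsPreconnected Dᶜ := by
  by_cases h : IsPreconnected Cᶜ
  · exact ⟨C, subset_rfl, hC, hCc, hne, h⟩
  obtain ⟨P, Q, hP, hQ, hPn, hQn, hd, he⟩ := not_preconn_open hC.isOpen_compl h
  have he' : Q ∪ P = Cᶜ := by rw [Set.union_comm]; exact he
  have hc : (C ∪ Q)ᶜ = P := by
    ext x
    have h1 : x ∈ P ∪ Q ↔ x ∈ Cᶜ := by rw [he]
    have h2 := fun a b => Set.disjoint_left.1 hd (show x ∈ P from a) (show x ∈ Q from b)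
    simp only [Set.mem_union, Set.mem_compl_iff] at *
    tauto
  refine ⟨C ∪ Q, Set.subset_union_left, closed_of_split hP hd.symm he',
    union_split_conn hC hCc hCn hQ hP hd.symm he', by rwa [hc], ?_⟩
  rw [hc]
  by_contra hP2
  obtain ⟨P1, P2, hP1, hP2, hn1, hn2, hd2, he2⟩ := not_preconn_open hP hP2
  rw [← he2, Set.disjoint_union_left] at hd
  rw [← he2] at he
  exact no_three hcv hC hCc hCn hP1 hP2 hQ hd2 hd.2 hd.1 he hn1 hn2 hQn

lemma end_above [LinearOrder X] (hcv : ConvexOrd X) {C : Set X} (hC : IsClosed C)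
    (hCc : IsPreconnected C) {c : X} (hcC : c ∈ C) (hne : Cᶜ.Nonempty) (hup : ∀ y, y ∉ C → c < y) :
    ∃ z ∉ C, ∀ L, IsClosed L → IsPreconnected L → z ∈ L → (L ∩ C).Nonempty → Cᶜ ⊆ L := by
  by_contra hcon
  push Not at hcon
  obtain ⟨b, hbc, hb0, hb⟩ := TopologicalSpace.exists_countable_basis X
  let ι := {B : Set X // B ∈ b ∧ B ⊆ Cᶜ}
  have : Countable ι := (hbc.mono (fun B hB => hB.1 : {B : Set X | B ∈ b ∧ B ⊆ Cᶜ} ⊆ b)).to_subtype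
  let K : ι → Set X := fun B => connectedComponentIn B.1ᶜ c
  have hBo : ∀ B : ι, IsOpen B.1 := fun B => hb.isOpen B.2.1
  have hBn : ∀ B : ι, B.1.Nonempty := fun B => by
    rw [Set.nonempty_iff_ne_empty]; intro h; exact hb0 (h ▸ B.2.1)
  have hK : ∀ B, IsClosed (K B) := fun B => compIn_closed (hBo B).isClosed_compl c
  have hKc : ∀ B, IsPreconnected (K B) := fun B => isPreconnected_connectedComponentIn
  have hCB : ∀ B : ι, C ⊆ B.1ᶜ := fun B => Set.subset_compl_comm.1 B.2.2
  have hCK : ∀ B, C ⊆ K B := fun B => hCc.subset_connectedComponentIn hcC (hCB B)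
  have hKB : ∀ B : ι, K B ⊆ B.1ᶜ := fun B => connectedComponentIn_subset _ _
  have hcov1 : ∀ z ∉ C, ∃ B, z ∈ K B := by
    intro z hz
    obtain ⟨L, hL, hLc, hzL, hLC, hnot⟩ := hcon z hz
    obtain ⟨e, he, heL⟩ := Set.not_subset.1 hnot
    have hop : IsOpen (Cᶜ ∩ Lᶜ) := hC.isOpen_compl.inter hL.isOpen_compl
    obtain ⟨B, hBb, heB, hBs⟩ := hb.exists_subset_of_mem_open (show e ∈ Cᶜ ∩ Lᶜ from ⟨he, heL⟩) hop
    refine ⟨⟨B, hBb, hBs.trans Set.inter_subset_left⟩, ?_⟩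
    have hLCc : IsPreconnected (L ∪ C) := IsPreconnected.union' hLC hLc hCc
    refine hLCc.subset_connectedComponentIn (Or.inr hcC) ?_ (Or.inl hzL)
    rintro w (hw | hw) hwB
    · exact (hBs hwB).2 hw
    · exact (hBs hwB).1 hw
  obtain ⟨p0, hp0⟩ := hne
  obtain ⟨B0, hB0⟩ := hcov1 p0 hp0
  have : Nonempty ι := ⟨B0⟩
  have hcov : ∀ z, ∃ B, z ∈ K B := fun z => by
    by_cases hz : z ∈ C
    · exact ⟨B0, hCK B0 hz⟩
    · exact hcov1 z hz
  have hdense : Dense (⋃ B, interior (K B)) :=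
    dense_iUnion_interior_of_closed hK (by ext z; simpa using hcov z)
  have hconn : ∀ B, IsPreconnected (K B)ᶜ := by
    intro B
    by_contra hn
    obtain ⟨P, Q, hP, hQ, ⟨s, hs⟩, ⟨t, ht⟩, hd, he⟩ := not_preconn_open (hK B).isOpen_compl hn
    have key : ∀ P Q : Set X, IsOpen P → IsOpen Q → Disjoint P Q → P ∪ Q = (K B)ᶜ →
        ∀ s ∈ P, ∀ t ∈ Q, s ≤ t → False := by
      intro P Q hP hQ hd he s hs t ht hst
      have he' : Q ∪ P = (K B)ᶜ := by rw [Set.union_comm]; exact he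
      have hsK : s ∉ K B := by
        have : s ∈ (K B)ᶜ := by rw [← he]; exact Or.inl hs
        exact this
      have := hcv _ (closed_of_split hP hd.symm he')
        (union_split_conn (hK B) (hKc B) ⟨c, hCK B hcC⟩ hQ hP hd.symm he') c s t
        (Or.inl (hCK B hcC)) (Or.inr ht) (hup s fun h => hsK (hCK B h)).le hst
      rcases this with h | h
      · exact hsK h
      · exact Set.disjoint_left.1 hd hs h
    rcases le_total s t with h | h
    · exact key P Q hP hQ hd he s hs t ht h
    · exact key Q P hQ hP hd.symm (by rw [Set.union_comm]; exact he) t ht s hs h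
  have hnest : ∀ B B', K B ⊆ K B' ∨ K B' ⊆ K B := by
    intro B B'
    by_contra hn
    rw [not_or] at hn
    obtain ⟨y, hy, hy'⟩ := Set.not_subset.1 hn.1
    obtain ⟨z, hz, hz'⟩ := Set.not_subset.1 hn.2
    rcases le_total y z with h | h
    · exact hy' (hcv _ (hK B') (hKc B') c y z (hCK _ hcC) hz (hup y fun h => hy' (hCK _ h)).le h)
    · exact hz' (hcv _ (hK B) (hKc B) c z y (hCK _ hcC) hy (hup z fun h => hz' (hCK _ h)).le h)
  have hBK : ∀ B : ι, ∀ e ∈ B.1, e ∉ K B := fun B e he h => hKB B h he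
  have hint : (⋂ B, closure (K B)ᶜ).Nonempty := by
    refine IsCompact.nonempty_iInter_of_directed_nonempty_isCompact_isClosed _ ?_ ?_ ?_ ?_
    · intro B B'
      rcases hnest B B' with h | h
      · exact ⟨B', closure_mono (Set.compl_subset_compl.2 h), subset_rfl⟩
      · exact ⟨B, subset_rfl, closure_mono (Set.compl_subset_compl.2 h)⟩
    · intro B
      obtain ⟨e, he⟩ := hBn B
      exact ⟨e, subset_closure (hBK B e he)⟩
    · intro B; exact isClosed_closure.isCompact
    · intro B; exact isClosed_closure
  obtain ⟨z, hz⟩ := hint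
  rw [Set.mem_iInter] at hz
  obtain ⟨A, hA⟩ := hcov z
  obtain ⟨e0, he0⟩ := hBn A
  obtain ⟨d, hd1, hd2⟩ := hdense.inter_open_nonempty _ (hK A).isOpen_compl ⟨e0, hBK A e0 he0⟩
  obtain ⟨B, hB⟩ := Set.mem_iUnion.1 hd2
  obtain ⟨e, he⟩ := hBn B
  have heK := hBK B e he
  have hce : c < e := hup e fun h => heK (hCK _ h)
  have hcd : c < d := hup d fun h => hd1 (hCK _ h)
  have hzd : z ≤ d := by
    by_contra h
    exact hd1 (hcv _ (hK A) (hKc A) c d z (hCK _ hcC) hA hcd.le (not_le.1 h).le)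
  have hde : d ≤ e := by
    by_contra h
    exact heK (hcv _ (hK B) (hKc B) c e d (hCK _ hcC) (interior_subset hB) hce.le (not_le.1 h).le)
  have := hcv _ isClosed_closure (hconn B).closure z d e (hz B) (subset_closure heK) hzd hde
  rw [closure_compl] at this
  exact this hB

lemma end_exists [o : LinearOrder X] (hcv : ConvexOrd X) {C : Set X} (hC : IsClosed C)
    (hCc : IsPreconnected C) (hi : (interior C).Nonempty) (hne : Cᶜ.Nonempty)
    (hcc : IsPreconnected Cᶜ) :
    ∃ z ∉ C, ∀ L, IsClosed L → IsPreconnected L → z ∈ L → (L ∩ C).Nonempty → Cᶜ ⊆ L := by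
  obtain ⟨c, hc⟩ := hi
  have hcC := interior_subset hc
  have hbet : ∀ y z, y ∉ C → z ∉ C → y ≤ c → c ≤ z → False := by
    intro y z hy hz h1 h2
    have := hcv _ isClosed_closure hcc.closure y c z (subset_closure hy) (subset_closure hz) h1 h2
    rw [closure_compl] at this
    exact this hc
  by_cases hup : ∀ y, y ∉ C → c < y
  · exact end_above hcv hC hCc hcC hne hup
  · push Not at hup
    obtain ⟨y, hy, hyc⟩ := hup
    have hdn : ∀ z, z ∉ C → z < c := fun z hz => by
      by_contra h; exact hbet y z hy hz hyc (not_lt.1 h)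
    let o' : LinearOrder X := inferInstanceAs (LinearOrder Xᵒᵈ)
    refine @end_above X _ _ _ o' ?_ C hC hCc c hcC hne hdn
    intro L hL hLc x y z hx hz hxy hyz
    exact hcv L hL hLc z y x hz hx hyz hxy

lemma irreducible_of_order [LinearOrder X] (hcv : ConvexOrd X) :
    ∃ a b : X, ∀ L : Set X, IsClosed L → IsPreconnected L → a ∈ L → b ∈ L → L = univ := by
  by_cases h : ∃ C : Set X, IsClosed C ∧ IsPreconnected C ∧ (interior C).Nonempty ∧ Cᶜ.Nonempty
  · obtain ⟨C0, h0, h0c, h0i, h0n⟩ := h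
    obtain ⟨C, hCs, hC, hCc, hCn, hCcc⟩ := split_ext hcv h0 h0c (h0i.mono interior_subset) h0n
    have hCi : (interior C).Nonempty := h0i.mono (interior_mono hCs)
    obtain ⟨z, hz, hzL⟩ := end_exists hcv hC hCc hCi hCn hCcc
    obtain ⟨D, hDs, hD, hDc, hDn, hDcc⟩ := split_ext hcv (isClosed_closure (s := Cᶜ)) hCcc.closure
      hCn.closure (by rw [closure_compl, compl_compl]; exact hCi)
    have hCD : Cᶜ ⊆ D := subset_closure.trans hDs
    have hDi : (interior D).Nonempty :=
      hCn.mono (interior_maximal hCD hC.isOpen_compl)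
    obtain ⟨w, hw, hwL⟩ := end_exists hcv hD hDc hDi hDn hDcc
    have hwC : w ∈ C := by by_contra h; exact hw (hCD h)
    refine ⟨z, w, fun L hL hLc hzL' hwL' => ?_⟩
    have h1 := hzL L hL hLc hzL' ⟨w, hwL', hwC⟩
    have h2 := hwL L hL hLc hwL' ⟨z, hzL', hCD hz⟩
    refine Set.eq_univ_of_forall fun r => ?_
    by_contra hr
    have hrC : r ∈ C := by by_contra h; exact hr (h1 h)
    have hrD : r ∈ D := by by_contra h; exact hr (h2 h)
    have hzD : z ∈ D := hCD hz
    rcases le_total r z with a | a <;> rcases le_total r w with b | b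
    · rcases le_total z w with c | c
      · exact hz (hcv C hC hCc r z w hrC hwC a c)
      · exact hw (hcv D hD hDc r w z hrD hzD b c)
    · exact hr (hcv L hL hLc w r z hwL' hzL' b a)
    · exact hr (hcv L hL hLc z r w hzL' hwL' a b)
    · rcases le_total z w with c | c
      · exact hw (hcv D hD hDc z w r hzD hrD c b)
      · exact hz (hcv C hC hCc w z r hwC hrC c a)
  · push Not at h
    obtain ⟨c⟩ : Nonempty X := inferInstance
    by_contra hcon
    push Not at hcon
    obtain ⟨b, hbc, hb0, hb⟩ := TopologicalSpace.exists_countable_basis X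
    have : Countable b := hbc.to_subtype
    let K : b → Set X := fun B => connectedComponentIn B.1ᶜ c
    have hK : ∀ B, IsClosed (K B) := fun B => compIn_closed (hb.isOpen B.2).isClosed_compl c
    have hcov : ⋃ B, K B = univ := by
      refine Set.eq_univ_of_forall fun x => ?_
      obtain ⟨L, hL, hLc, hc, hx, hne⟩ := hcon c x
      obtain ⟨e, he⟩ := (Set.ne_univ_iff_exists_notMem _).1 hne
      obtain ⟨B, hBb, heB, hBs⟩ := hb.exists_subset_of_mem_open (show e ∈ Lᶜ from he) hL.isOpen_compl
      exact Set.mem_iUnion.2 ⟨⟨B, hBb⟩, hLc.subset_connectedComponentIn hc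
        (Set.subset_compl_comm.1 hBs) hx⟩
    obtain ⟨B, hB⟩ := nonempty_interior_of_iUnion_of_closed hK hcov
    have h3 := h (K B) (hK B) isPreconnected_connectedComponentIn hB
    have hBn : B.1.Nonempty := by
      rw [Set.nonempty_iff_ne_empty]; intro h; exact hb0 (h ▸ B.2)
    obtain ⟨e, he⟩ := hBn
    have : e ∈ (K B)ᶜ := fun h => connectedComponentIn_subset _ _ h he
    rw [h3] at this
    exact this

lemma irreducible_exists (hX : Chainable X) :
    ∃ a b : X, ∀ L : Set X, IsClosed L → IsPreconnected L → a ∈ L → b ∈ L → L = univ := by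
  obtain ⟨o, ho⟩ := chain_order_exists hX
  exact irreducible_of_order ho

end Irred

section Gap
variable {X : Type} [TopologicalSpace X] [ConnectedSpace X]

/-- `X` is irreducible between `a` and `b`. -/
def IrrBetween (a b : X) : Prop :=
  ∀ L : Set X, IsClosed L → IsPreconnected L → a ∈ L → b ∈ L → L = univ

lemma IrrBetween.symm {a b : X} (h : IrrBetween a b) : IrrBetween b a :=
  fun L h1 h2 h3 h4 => h L h1 h2 h4 h3

/-- `M` is the union of two proper closed connected subsets. -/
def Dec (M : Set X) : Prop :=
  ∃ H K : Set X, IsClosed H ∧ IsPreconnected H ∧ IsClosed K ∧ IsPreconnected K ∧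
    H ∪ K = M ∧ H ≠ M ∧ K ≠ M

lemma gap_sep {a b : X} (hI : IrrBetween a b) {A B P Q : Set X} (hA : IsClosed A)
    (hAc : IsPreconnected A) (ha : a ∈ A) (hB : IsClosed B) (hBc : IsPreconnected B) (hb : b ∈ B)
    (hP : IsOpen P) (hQ : IsOpen Q) (hd : Disjoint P Q) (he : P ∪ Q = (A ∪ B)ᶜ)
    (hQn : Q.Nonempty) :
    ∃ S T : Set X, IsClosed S ∧ IsClosed T ∧ Disjoint S T ∧ A ⊆ S ∧ B ⊆ T ∧ S ∪ T = A ∪ B ∪ P := by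
  have hF : IsClosed (A ∪ B ∪ P) := closed_of_split hQ hd he
  have hF' : IsClosed (A ∪ B ∪ Q) := closed_of_split hP hd.symm (by rw [Set.union_comm]; exact he)
  have hnc : ¬ IsPreconnected (A ∪ B ∪ P) := by
    intro h
    have := hI _ hF h (Or.inl (Or.inl ha)) (Or.inl (Or.inr hb))
    obtain ⟨q, hq⟩ := hQn
    have h1 : q ∈ A ∪ B ∪ P := by rw [this]; trivial
    have h2 : q ∈ (A ∪ B)ᶜ := by rw [← he]; exact Or.inr hq
    rcases h1 with h1 | h1
    · exact h2 h1
    · exact Set.disjoint_left.1 hd h1 hq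
  rw [isPreconnected_iff_subset_of_fully_disjoint_closed hF] at hnc
  push Not at hnc
  obtain ⟨u, v, hu, hv, hc, huv, hnu, hnv⟩ := hnc
  have key : ∀ u v : Set X, IsClosed u → IsClosed v → A ∪ B ∪ P ⊆ u ∪ v → Disjoint u v →
      ¬ A ∪ B ∪ P ⊆ u → A ⊆ u → B ⊆ u → False := by
    intro u v hu hv hc huv hnu hAu hBu
    have hclop : IsClopen (v ∩ (A ∪ B ∪ P)) := by
      refine ⟨hv.inter hF, ?_⟩
      have : v ∩ (A ∪ B ∪ P) = ((u ∩ (A ∪ B ∪ P)) ∪ (A ∪ B ∪ Q))ᶜ := by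
        ext x
        have h1 : x ∈ P ∪ Q ↔ x ∈ (A ∪ B)ᶜ := by rw [he]
        have h2 := fun a b => Set.disjoint_left.1 hd (show x ∈ P from a) (show x ∈ Q from b)
        have h3 := fun a b => Set.disjoint_left.1 huv (show x ∈ u from a) (show x ∈ v from b)
        have h4 := @hc x
        have h5 := @hAu x
        have h6 := @hBu x
        simp only [Set.mem_union, Set.mem_compl_iff, Set.mem_inter_iff] at h1 h4 ⊢
        grind
      rw [this]
      exact ((hu.inter hF).union hF').isOpen_compl
    rcases isClopen_iff.1 hclop with h | h
    · apply hnu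
      intro x hx
      rcases hc hx with h' | h'
      · exact h'
      · have : x ∈ v ∩ (A ∪ B ∪ P) := ⟨h', hx⟩
        rw [h] at this; exact this.elim
    · have : a ∈ v ∩ (A ∪ B ∪ P) := by rw [h]; trivial
      exact (Set.disjoint_left.1 huv (hAu ha) this.1).elim
  have key2 : ∀ u v : Set X, IsClosed u → IsClosed v → A ∪ B ∪ P ⊆ u ∪ v → Disjoint u v →
      A ⊆ u → B ⊆ v → ∃ S T : Set X, IsClosed S ∧ IsClosed T ∧ Disjoint S T ∧ A ⊆ S ∧ B ⊆ T ∧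
        S ∪ T = A ∪ B ∪ P := by
    intro u v hu hv hc huv hAu hBv
    refine ⟨u ∩ (A ∪ B ∪ P), v ∩ (A ∪ B ∪ P), hu.inter hF, hv.inter hF,
      huv.mono Set.inter_subset_left Set.inter_subset_left,
      fun x hx => ⟨hAu hx, Or.inl (Or.inl hx)⟩, fun x hx => ⟨hBv hx, Or.inl (Or.inr hx)⟩, ?_⟩
    rw [← Set.union_inter_distrib_right]
    exact Set.inter_eq_right.2 hc
  have hA2 := (isPreconnected_iff_subset_of_fully_disjoint_closed hA).1 hAc u v hu hv
    (fun x hx => hc (Or.inl (Or.inl hx))) huv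
  have hB2 := (isPreconnected_iff_subset_of_fully_disjoint_closed hB).1 hBc u v hu hv
    (fun x hx => hc (Or.inl (Or.inr hx))) huv
  have hc' : A ∪ B ∪ P ⊆ v ∪ u := by rwa [Set.union_comm v u]
  rcases hA2 with h | h <;> rcases hB2 with h' | h'
  · exact (key u v hu hv hc huv hnu h h').elim
  · exact key2 u v hu hv hc huv h h'
  · exact key2 v u hv hu hc' huv.symm h h'
  · exact (key v u hv hu hc' huv.symm hnv h h').elim

lemma gap_conn {a b : X} (hI : IrrBetween a b) {A B : Set X} (hA : IsClosed A)
    (hAc : IsPreconnected A) (ha : a ∈ A) (hB : IsClosed B) (hBc : IsPreconnected B) (hb : b ∈ B) :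
    IsPreconnected (A ∪ B)ᶜ := by
  by_contra hn
  obtain ⟨P, Q, hP, hQ, hPn, hQn, hd, he⟩ := not_preconn_open (hA.union hB).isOpen_compl hn
  have he' : Q ∪ P = (A ∪ B)ᶜ := by rw [Set.union_comm]; exact he
  obtain ⟨S, T, hS, hT, hST, hAS, hBT, e1⟩ := gap_sep hI hA hAc ha hB hBc hb hP hQ hd he hQn
  obtain ⟨S', T', hS', hT', hST', hAS', hBT', e2⟩ :=
    gap_sep hI hA hAc ha hB hBc hb hQ hP hd.symm he' hPn
  have hcov : (S ∪ S') ∪ (T ∪ T') = univ := by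
    refine Set.eq_univ_of_forall fun x => ?_
    have h1 : x ∈ P ∪ Q ↔ x ∈ (A ∪ B)ᶜ := by rw [he]
    have h2 : x ∈ S ∪ T ↔ x ∈ A ∪ B ∪ P := by rw [e1]
    have h3 : x ∈ S' ∪ T' ↔ x ∈ A ∪ B ∪ Q := by rw [e2]
    simp only [Set.mem_union, Set.mem_compl_iff] at h1 h2 h3 ⊢
    grind
  obtain ⟨x, hx, hx'⟩ := cover_meet (hS.union hS') (hT.union hT') hcov ⟨a, Or.inl (hAS ha)⟩
    ⟨b, Or.inl (hBT hb)⟩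
  have h1 : x ∈ P ∪ Q ↔ x ∈ (A ∪ B)ᶜ := by rw [he]
  have h2 : x ∈ S ∪ T ↔ x ∈ A ∪ B ∪ P := by rw [e1]
  have h3 : x ∈ S' ∪ T' ↔ x ∈ A ∪ B ∪ Q := by rw [e2]
  have h4 := fun a b => Set.disjoint_left.1 hd (show x ∈ P from a) (show x ∈ Q from b)
  have h5 := fun a b => Set.disjoint_left.1 hST (show x ∈ S from a) (show x ∈ T from b)
  have h6 := fun a b => Set.disjoint_left.1 hST' (show x ∈ S' from a) (show x ∈ T' from b)
  have h7 := @hAS x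
  have h8 := @hBT x
  have h9 := @hAS' x
  have h10 := @hBT' x
  simp only [Set.mem_union, Set.mem_compl_iff] at h1 h2 h3 hx hx'
  clear he he' e1 e2 hcov
  grind

lemma gap_disj {a b : X} (hI : IrrBetween a b) {A B : Set X} (hA : IsClosed A)
    (hAc : IsPreconnected A) (ha : a ∈ A) (hB : IsClosed B) (hBc : IsPreconnected B) (hb : b ∈ B)
    (hne : A ∪ B ≠ univ) : ∀ x, x ∈ A → x ∈ B → False := by
  intro x hx hx'
  exact hne (hI _ (hA.union hB) (IsPreconnected.union x hx hx' hAc hBc) (Or.inl ha) (Or.inr hb))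

lemma gap_meet {a b : X} (hI : IrrBetween a b) {A B : Set X} (hA : IsClosed A)
    (hAc : IsPreconnected A) (ha : a ∈ A) (hB : IsClosed B) (hBc : IsPreconnected B) (hb : b ∈ B)
    (hne : A ∪ B ≠ univ) : (A ∩ closure (A ∪ B)ᶜ).Nonempty := by
  have hcov : A ∪ (closure (A ∪ B)ᶜ ∪ B) = univ := by
    refine Set.eq_univ_of_forall fun x => ?_
    by_cases hx : x ∈ A ∪ B
    · rcases hx with h | h
      · exact Or.inl h
      · exact Or.inr (Or.inr h)
    · exact Or.inr (Or.inl (subset_closure hx))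
  obtain ⟨x, hx, hx' | hx'⟩ := cover_meet hA (isClosed_closure.union hB) hcov ⟨a, ha⟩
    ⟨b, Or.inr hb⟩
  · exact ⟨x, hx, hx'⟩
  · exact (gap_disj hI hA hAc ha hB hBc hb hne x hx hx').elim

lemma gap_insert {a b : X} (hI : IrrBetween a b) {A B : Set X} (hA : IsClosed A)
    (hAc : IsPreconnected A) (ha : a ∈ A) (hB : IsClosed B) (hBc : IsPreconnected B) (hb : b ∈ B)
    (hne : A ∪ B ≠ univ) (hD : Dec (closure (A ∪ B)ᶜ)) :
    ∃ H K : Set X, IsClosed H ∧ IsClosed K ∧ H ∪ K = closure (A ∪ B)ᶜ ∧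
      IsPreconnected (A ∪ H) ∧ IsPreconnected (B ∪ K) ∧ A ∪ (B ∪ K) ≠ univ ∧
      (A ∪ H) ∪ B ≠ univ := by
  obtain ⟨H, K, hH, hHc, hK, hKc, hu, hHn, hKn⟩ := hD
  have hbig : ∀ H K : Set X, IsClosed H → H ∪ K = closure (A ∪ B)ᶜ → H ≠ closure (A ∪ B)ᶜ →
      (A ∪ H) ∪ B ≠ univ := by
    intro H K hH hu hn h
    apply hn
    apply Set.Subset.antisymm
    · rw [← hu]; exact Set.subset_union_left
    · refine closure_minimal ?_ hH
      intro x hx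
      have : x ∈ (A ∪ H) ∪ B := by rw [h]; trivial
      rcases this with (h | h) | h
      · exact (hx (Or.inl h)).elim
      · exact h
      · exact (hx (Or.inr h)).elim
  have hu' : K ∪ H = closure (A ∪ B)ᶜ := by rw [Set.union_comm]; exact hu
  have hbH := hbig H K hH hu hHn
  have hbK := hbig K H hK hu' hKn
  have hnot : ∀ H : Set X, IsClosed H → IsPreconnected H → (A ∪ H) ∪ B ≠ univ →
      (A ∩ H).Nonempty → (B ∩ H).Nonempty → False := by
    intro H hH hHc hn h1 h2
    apply hn
    refine hI _ ((hA.union hH).union hB) ?_ (Or.inl (Or.inl ha)) (Or.inr hb)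
    obtain ⟨y, hy, hy'⟩ := h2
    exact IsPreconnected.union y (Or.inr hy') hy (IsPreconnected.union' h1 hAc hHc) hBc
  have mA := gap_meet hI hA hAc ha hB hBc hb hne
  have mB := gap_meet hI.symm hB hBc hb hA hAc ha (by rwa [Set.union_comm])
  rw [Set.union_comm B A] at mB
  rw [← hu] at mA mB
  obtain ⟨x, hx, hx'⟩ := mA
  obtain ⟨y, hy, hy'⟩ := mB
  have fin : ∀ H K : Set X, IsClosed H → IsPreconnected H → IsClosed K → IsPreconnected K →
      H ∪ K = closure (A ∪ B)ᶜ → (A ∪ H) ∪ B ≠ univ → (A ∪ K) ∪ B ≠ univ →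
      (A ∩ H).Nonempty → (B ∩ K).Nonempty → ∃ H K : Set X, IsClosed H ∧ IsClosed K ∧ H ∪ K = closure (A ∪ B)ᶜ ∧
      IsPreconnected (A ∪ H) ∧ IsPreconnected (B ∪ K) ∧ A ∪ (B ∪ K) ≠ univ ∧
      (A ∪ H) ∪ B ≠ univ := by
    intro H K hH hHc hK hKc hu h1 h2 h3 h4
    refine ⟨H, K, hH, hK, hu, IsPreconnected.union' h3 hAc hHc, IsPreconnected.union' h4 hBc hKc,
      ?_, h1⟩
    rwa [Set.union_comm B K, ← Set.union_assoc]
  rcases hx' with hx' | hx' <;> rcases hy' with hy' | hy'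
  · exact (hnot H hH hHc hbH ⟨x, hx, hx'⟩ ⟨y, hy, hy'⟩).elim
  · exact fin H K hH hHc hK hKc hu hbH hbK ⟨x, hx, hx'⟩ ⟨y, hy, hy'⟩
  · exact fin K H hK hKc hH hHc hu' hbK hbH ⟨x, hx, hx'⟩ ⟨y, hy, hy'⟩
  · exact (hnot K hK hKc hbK ⟨x, hx, hx'⟩ ⟨y, hy, hy'⟩).elim

lemma fat_dec {a b : X} (hI : IrrBetween a b) {A B E U : Set X} (hA : IsClosed A)
    (hAc : IsPreconnected A) (ha : a ∈ A) (hB : IsClosed B) (hBc : IsPreconnected B) (hb : b ∈ B)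
    (hE : IsClosed E) (hEc : IsPreconnected E) (hAE : A ⊆ E) (hU : IsOpen U) (hUn : U.Nonempty)
    (hUO : U ⊆ (A ∪ B)ᶜ) (hUE : U ⊆ E) (hne : E ∪ B ≠ univ) : Dec (closure (A ∪ B)ᶜ) := by
  have hO2 := gap_conn hI hE hEc (hAE ha) hB hBc hb
  have m2 := gap_meet hI.symm hB hBc hb hE hEc (hAE ha) (by rwa [Set.union_comm])
  rw [Set.union_comm B E] at m2
  set N := closure (E ∪ B)ᶜ with hN
  have hBN : IsPreconnected (B ∪ N) := IsPreconnected.union' m2 hBc hO2.closure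
  have hBNc : IsClosed (B ∪ N) := hB.union isClosed_closure
  have hO3 := gap_conn hI hA hAc ha hBNc hBN (Or.inl hb)
  have hUN : Disjoint U N := by
    rw [hN]
    refine Disjoint.closure_right ?_ hU
    rw [Set.disjoint_left]
    intro x hx hx'
    exact hx' (Or.inl (hUE hx))
  obtain ⟨x, hx⟩ := hUn
  obtain ⟨e, he⟩ := (Set.ne_univ_iff_exists_notMem _).1 hne
  have hOO : (E ∪ B)ᶜ ⊆ (A ∪ B)ᶜ := Set.compl_subset_compl.2 (Set.union_subset_union_left _ hAE)
  refine ⟨closure (A ∪ (B ∪ N))ᶜ, N, isClosed_closure, hO3.closure, isClosed_closure, hO2.closure,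
    ?_, ?_, ?_⟩
  · apply Set.Subset.antisymm
    · refine Set.union_subset (closure_mono ?_) (closure_mono hOO)
      rw [← Set.union_assoc]
      exact Set.compl_subset_compl.2 Set.subset_union_left
    · refine closure_minimal ?_ (isClosed_closure.union isClosed_closure)
      intro y hy
      by_cases hyN : y ∈ N
      · exact Or.inr hyN
      · refine Or.inl (subset_closure ?_)
        rintro (h | h | h)
        · exact hy (Or.inl h)
        · exact hy (Or.inr h)
        · exact hyN h
  · intro h
    have h1 : e ∈ closure (A ∪ (B ∪ N))ᶜ := by rw [h]; exact subset_closure (hOO he)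
    have h2 : Disjoint (E ∪ B)ᶜ (closure (A ∪ (B ∪ N))ᶜ) := by
      refine Disjoint.closure_right ?_ (hE.union hB).isOpen_compl
      rw [Set.disjoint_left]
      intro y hy hy'
      exact hy' (Or.inr (Or.inr (subset_closure hy)))
    exact Set.disjoint_left.1 h2 he h1
  · intro h
    have h1 : x ∈ N := by rw [h]; exact subset_closure (hUO hx)
    exact Set.disjoint_left.1 hUN hx h1

lemma fat_dec_meet {a b : X} (hI : IrrBetween a b) {A B K U : Set X} (hA : IsClosed A)
    (hAc : IsPreconnected A) (ha : a ∈ A) (hB : IsClosed B) (hBc : IsPreconnected B) (hb : b ∈ B)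
    (hK : IsClosed K) (hKc : IsPreconnected K) (hU : IsOpen U) (hUn : U.Nonempty)
    (hUO : U ⊆ (A ∪ B)ᶜ) (hUK : U ⊆ K) {e : X} (he : e ∉ A ∪ B) (heK : e ∉ K)
    (hm : (A ∩ K).Nonempty) : Dec (closure (A ∪ B)ᶜ) := by
  refine fat_dec hI hA hAc ha hB hBc hb (hA.union hK) (IsPreconnected.union' hm hAc hKc)
    Set.subset_union_left hU hUn hUO (hUK.trans Set.subset_union_right) ?_
  intro h
  have : e ∈ A ∪ K ∪ B := by rw [h]; trivial
  rcases this with (h | h) | h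
  · exact he (Or.inl h)
  · exact heK h
  · exact he (Or.inr h)

lemma no_fat {a b : X} (hI : IrrBetween a b) {A B K U : Set X} (hA : IsClosed A)
    (hAc : IsPreconnected A) (ha : a ∈ A) (hB : IsClosed B) (hBc : IsPreconnected B) (hb : b ∈ B)
    (hK : IsClosed K) (hKc : IsPreconnected K) (hU : IsOpen U) (hUn : U.Nonempty)
    (hUO : U ⊆ (A ∪ B)ᶜ) (hUK : U ⊆ K) {e : X} (he : e ∉ A ∪ B) (heK : e ∉ K) :
    Dec (closure (A ∪ B)ᶜ) := by
  have L1 : ∀ K : Set X, IsClosed K → IsPreconnected K → U ⊆ K → e ∉ K → (A ∩ K).Nonempty →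
      Dec (closure (A ∪ B)ᶜ) := fun K hK hKc hUK heK hm =>
    fat_dec_meet hI hA hAc ha hB hBc hb hK hKc hU hUn hUO hUK he heK hm
  have L2 : ∀ K : Set X, IsClosed K → IsPreconnected K → U ⊆ K → e ∉ K → (B ∩ K).Nonempty →
      Dec (closure (A ∪ B)ᶜ) := fun K hK hKc hUK heK hm => by
    rw [Set.union_comm A B]
    rw [Set.union_comm A B] at he hUO
    exact fat_dec_meet hI.symm hB hBc hb hA hAc ha hK hKc hU hUn hUO hUK he heK hm
  by_cases hm1 : (A ∩ K).Nonempty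
  · exact L1 K hK hKc hUK heK hm1
  by_cases hm2 : (B ∩ K).Nonempty
  · exact L2 K hK hKc hUK heK hm2
  have hAK : A ⊆ Kᶜ := fun x hx hx' => hm1 ⟨x, hx, hx'⟩
  have hBK : B ⊆ Kᶜ := fun x hx hx' => hm2 ⟨x, hx, hx'⟩
  have hKn : K.Nonempty := hUn.mono hUK
  have hnc : ¬ IsPreconnected Kᶜ := by
    intro h
    have h1 := hI _ isClosed_closure h.closure (subset_closure (hAK ha)) (subset_closure (hBK hb))
    obtain ⟨x, hx⟩ := hUn
    have h2 : x ∈ closure Kᶜ := by rw [h1]; trivial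
    rw [closure_compl] at h2
    exact h2 (interior_maximal hUK hU hx)
  obtain ⟨P, Q, hP, hQ, hPn, hQn, hd, hPQ⟩ := not_preconn_open hK.isOpen_compl hnc
  have hQP : Q ∪ P = Kᶜ := by rw [Set.union_comm]; exact hPQ
  have cP := closed_of_split hQ hd hPQ
  have cQ := closed_of_split hP hd.symm hQP
  have pP := union_split_conn hK hKc hKn hP hQ hd hPQ
  have pQ := union_split_conn hK hKc hKn hQ hP hd.symm hQP
  have fin : ∀ P Q : Set X, Disjoint P Q → P ∪ Q = Kᶜ → IsClosed (K ∪ P) → IsPreconnected (K ∪ P) →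
      e ∈ Q → P.Nonempty → IsClosed (K ∪ Q) → IsPreconnected (K ∪ Q) → Dec (closure (A ∪ B)ᶜ) := by
    intro P Q hd hPQ cP pP heQ hPn cQ pQ
    have heP : e ∉ K ∪ P := by
      rintro (h | h)
      · exact heK h
      · exact Set.disjoint_left.1 hd h heQ
    have haP : a ∈ P ∪ Q := by rw [hPQ]; exact hAK ha
    rcases haP with h | h
    · exact L1 _ cP pP (hUK.trans Set.subset_union_left) heP ⟨a, ha, Or.inr h⟩
    · have hbP : b ∈ P ∪ Q := by rw [hPQ]; exact hBK hb
      rcases hbP with h' | h'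
      · exact L2 _ cP pP (hUK.trans Set.subset_union_left) heP ⟨b, hb, Or.inr h'⟩
      · have h1 := hI _ cQ pQ (Or.inr h) (Or.inr h')
        obtain ⟨p, hp⟩ := hPn
        have h2 : p ∈ K ∪ Q := by rw [h1]; trivial
        have h3 : p ∈ Kᶜ := by rw [← hPQ]; exact Or.inl hp
        rcases h2 with h2 | h2
        · exact (h3 h2).elim
        · exact (Set.disjoint_left.1 hd hp h2).elim
  have heK' : e ∈ P ∪ Q := by rw [hPQ]; exact heK
  rcases heK' with h | h
  · exact fin Q P hd.symm hQP cQ pQ h hQn cP pP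
  · exact fin P Q hd hPQ cP pP h hPn cQ pQ
end Gap

section Mycielski
variable {X : Type} [MetricSpace X] [CompactSpace X]

/-- A family of nonempty open subsets of `O`. -/
def GoodFam (O : Set X) (W : List Bool → Set X) : Prop :=
  ∀ s, IsOpen (W s) ∧ (W s).Nonempty ∧ W s ⊆ O

/-- Nonempty open boxes can be shrunk so as to avoid the relation. -/
def Avoidable (O : Set X) (R : X → X → Prop) : Prop :=
  ∀ U V : Set X, IsOpen U → IsOpen V → U.Nonempty → V.Nonempty → U ⊆ O → V ⊆ O →
    ∃ U' V' : Set X, IsOpen U' ∧ IsOpen V' ∧ U'.Nonempty ∧ V'.Nonempty ∧ U' ⊆ U ∧ V' ⊆ V ∧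
      ∀ x ∈ U', ∀ y ∈ V', ¬ R x y

lemma fam_shrink {O : Set X} {R : ℕ → X → X → Prop} (hR : ∀ n, Avoidable O (R n))
    (T : Finset (ℕ × List Bool × List Bool)) : (∀ t ∈ T, t.2.1 ≠ t.2.2) →
    ∀ W, GoodFam O W → ∃ W', GoodFam O W' ∧ (∀ s, W' s ⊆ W s) ∧
      ∀ t ∈ T, ∀ x ∈ W' t.2.1, ∀ y ∈ W' t.2.2, ¬ R t.1 x y := by
  classical
  induction T using Finset.induction_on with
  | empty => intro _ W hW; exact ⟨W, hW, fun s => subset_rfl, by simp⟩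
  | insert t T ht ih =>
    intro hne W hW
    obtain ⟨W1, hW1, hs1, hav⟩ := ih (fun u hu => hne u (Finset.mem_insert_of_mem hu)) W hW
    obtain ⟨n, s, s'⟩ := t
    have hss : s ≠ s' := hne (n, s, s') (Finset.mem_insert_self _ _)
    obtain ⟨U, V, hU, hV, hUn, hVn, hUs, hVs, hUV⟩ := hR n (W1 s) (W1 s') (hW1 s).1 (hW1 s').1
      (hW1 s).2.1 (hW1 s').2.1 (hW1 s).2.2 (hW1 s').2.2
    let W2 : List Bool → Set X := fun l => if l = s then U else if l = s' then V else W1 l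
    have hW2s : W2 s = U := by simp [W2]
    have hW2s' : W2 s' = V := by simp [W2, hss.symm]
    have hsub : ∀ l, W2 l ⊆ W1 l := by
      intro l
      by_cases h : l = s
      · subst h; rw [hW2s]; exact hUs
      · by_cases h' : l = s'
        · subst h'; rw [hW2s']; exact hVs
        · simp [W2, h, h']
    refine ⟨W2, ?_, fun l => (hsub l).trans (hs1 l), ?_⟩
    · intro l
      by_cases h : l = s
      · subst h; rw [hW2s]; exact ⟨hU, hUn, hUs.trans (hW1 _).2.2⟩
      · by_cases h' : l = s'
        · subst h'; rw [hW2s']; exact ⟨hV, hVn, hVs.trans (hW1 _).2.2⟩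
        · have : W2 l = W1 l := by simp [W2, h, h']
          rw [this]; exact hW1 l
    · intro t ht x hx y hy
      rcases Finset.mem_insert.1 ht with h | h
      · subst h
        simp only [hW2s, hW2s'] at hx hy
        exact hUV x hx y hy
      · exact hav t h x (hsub _ hx) y (hsub _ hy)

lemma fam_step {O : Set X} {R : ℕ → X → X → Prop} (hR : ∀ n, Avoidable O (R n)) (n : ℕ)
    (W : List Bool → Set X) (hW : GoodFam O W) :
    ∃ W', GoodFam O W' ∧ (∀ s, closure (W' s) ⊆ W s.tail) ∧
      ∀ i ≤ n, ∀ s t : List Bool, s.length = n + 1 → t.length = n + 1 → s ≠ t →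
        ∀ x ∈ W' s, ∀ y ∈ W' t, ¬ R i x y := by
  have h1 : ∀ s : List Bool, ∃ V : Set X, IsOpen V ∧ V.Nonempty ∧ closure V ⊆ W s.tail := by
    intro s
    obtain ⟨ho, ⟨x, hx⟩, -⟩ := hW s.tail
    obtain ⟨ε, hε, hs⟩ := Metric.isOpen_iff.1 ho x hx
    refine ⟨Metric.ball x (ε / 2), Metric.isOpen_ball, ⟨x, Metric.mem_ball_self (by linarith)⟩, ?_⟩
    refine Metric.closure_ball_subset_closedBall.trans
      ((Metric.closedBall_subset_ball (by linarith)).trans hs)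
  choose V hVo hVn hVc using h1
  have hVg : GoodFam O V := fun s => ⟨hVo s, hVn s, subset_closure.trans ((hVc s).trans (hW _).2.2)⟩
  have hfin : Set.Finite {t : ℕ × List Bool × List Bool | t.1 ≤ n ∧ t.2.1.length = n + 1 ∧
      t.2.2.length = n + 1 ∧ t.2.1 ≠ t.2.2} := by
    refine ((Set.finite_Iic n).prod ((List.finite_length_eq Bool (n + 1)).prod
      (List.finite_length_eq Bool (n + 1)))).subset ?_
    rintro t ⟨h1, h2, h3, -⟩
    exact ⟨h1, h2, h3⟩
  obtain ⟨W', hW', hs, hav⟩ := fam_shrink hR hfin.toFinset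
    (fun t ht => ((hfin.mem_toFinset).1 ht).2.2.2) V hVg
  refine ⟨W', hW', fun s => (closure_mono (hs s)).trans (hVc s), ?_⟩
  intro i hi s t hsl htl hst
  exact hav (i, s, t) ((hfin.mem_toFinset).2 ⟨hi, hsl, htl, hst⟩)

lemma mycielski {O : Set X} (hO : IsOpen O) (hOn : O.Nonempty) {R : ℕ → X → X → Prop}
    (hR : ∀ n, Avoidable O (R n)) :
    ∃ f : (ℕ → Bool) → X, ∀ x y, x ≠ y → ∀ n, ¬ R n (f x) (f y) := by
  choose! F hF1 hF2 hF3 using fam_step hR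
  let W : ℕ → List Bool → Set X := fun n => Nat.rec (fun _ => O) (fun n w => F n w) n
  have hW : ∀ n, GoodFam O (W n) := by
    intro n
    induction n with
    | zero => exact fun s => ⟨hO, hOn, subset_rfl⟩
    | succ n ih => exact hF1 n _ ih
  have hsub : ∀ n s, closure (W (n + 1) s) ⊆ W n s.tail := fun n s => hF2 n _ (hW n) s
  have hsub' : ∀ (x : ℕ → Bool) n, closure (W (n + 1) (PiNat.res x (n + 1))) ⊆ W n (PiNat.res x n) :=
    fun x n => by simpa using hsub n (PiNat.res x (n + 1))
  have hint : ∀ x : ℕ → Bool, ∃ p, ∀ n, p ∈ W n (PiNat.res x n) := by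
    intro x
    have := IsCompact.nonempty_iInter_of_sequence_nonempty_isCompact_isClosed
      (fun n => closure (W n (PiNat.res x n))) (fun n => (hsub' x n).trans subset_closure)
      (fun n => (hW n _).2.1.closure) isClosed_closure.isCompact (fun n => isClosed_closure)
    obtain ⟨p, hp⟩ := this
    exact ⟨p, fun n => hsub' x n (Set.mem_iInter.1 hp (n + 1))⟩
  choose f hf using hint
  refine ⟨f, fun x y hxy n => ?_⟩
  obtain ⟨m, hm⟩ := Function.ne_iff.1 hxy
  have hne : PiNat.res x (max n m + 1) ≠ PiNat.res y (max n m + 1) := by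
    intro h
    rw [PiNat.res_eq_res] at h
    exact hm (h (by omega))
  exact hF3 (max n m) (W (max n m)) (hW _) n (le_max_left _ _) _ _ (PiNat.res_length _ _)
    (PiNat.res_length _ _) hne _ (hf x (max n m + 1)) _ (hf y (max n m + 1))

end Mycielski

section Final
variable {X : Type} [MetricSpace X] [CompactSpace X] [ConnectedSpace X]

lemma gap_case {a b : X} (hI : IrrBetween a b) {A B : Set X} (hA : IsClosed A)
    (hAc : IsPreconnected A) (ha : a ∈ A) (hB : IsClosed B) (hBc : IsPreconnected B) (hb : b ∈ B)
    (hne : A ∪ B ≠ univ) (hD : ¬ Dec (closure (A ∪ B)ᶜ)) :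
    ∃ f : (ℕ → Bool) → X, ∀ x y, x ≠ y → ∀ L, IsClosed L → IsPreconnected L → interior L = ∅ →
      f x ∈ L → f y ∈ L → False := by
  set O := (A ∪ B)ᶜ with hOdef
  have hO : IsOpen O := (hA.union hB).isOpen_compl
  have hOn : O.Nonempty := Set.nonempty_compl.2 hne
  obtain ⟨bs, hbc, hb0, hbb⟩ := TopologicalSpace.exists_countable_basis X
  have hbs : ∀ G : Set X, IsOpen G → G.Nonempty → ∃ C ∈ bs, C ⊆ G := by
    rintro G hG ⟨x, hx⟩
    obtain ⟨C, hC, -, hs⟩ := hbb.exists_subset_of_mem_open hx hG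
    exact ⟨C, hC, hs⟩
  obtain ⟨C0, hC0, hC0s⟩ := hbs O hO hOn
  obtain ⟨g, hg⟩ := (hbc.mono (fun B hB => hB.1 : {B : Set X | B ∈ bs ∧ B ⊆ O} ⊆ bs)).exists_eq_range
    ⟨C0, hC0, hC0s⟩
  have hgm : ∀ n, g n ∈ bs ∧ g n ⊆ O := fun n => by
    have : g n ∈ {B : Set X | B ∈ bs ∧ B ⊆ O} := by rw [hg]; exact ⟨n, rfl⟩
    exact this
  have hgo : ∀ n, IsOpen (g n) := fun n => hbb.isOpen (hgm n).1
  have hgn : ∀ n, (g n).Nonempty := fun n => by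
    rw [Set.nonempty_iff_ne_empty]; intro h; exact hb0 (h ▸ (hgm n).1)
  let R : ℕ → X → X → Prop := fun n x y =>
    ∃ L, IsClosed L ∧ IsPreconnected L ∧ x ∈ L ∧ y ∈ L ∧ L ⊆ (g n)ᶜ
  have hR : ∀ n, Avoidable O (R n) := by
    intro n U V hU hV hUn hVn hUO hVO
    by_cases h1 : (U ∩ g n).Nonempty
    · refine ⟨U ∩ g n, V, hU.inter (hgo n), hV, h1, hVn, Set.inter_subset_left, subset_rfl, ?_⟩
      rintro x ⟨-, hx⟩ y hy ⟨L, -, -, hxL, -, hLg⟩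
      exact hLg hxL hx
    by_cases h2 : (V ∩ g n).Nonempty
    · refine ⟨U, V ∩ g n, hU, hV.inter (hgo n), hUn, h2, subset_rfl, Set.inter_subset_left, ?_⟩
      rintro x hx y ⟨-, hy⟩ ⟨L, -, -, -, hyL, hLg⟩
      exact hLg hyL hy
    have hUg : U ⊆ (g n)ᶜ := fun x hx hx' => h1 ⟨x, hx, hx'⟩
    have hVg : V ⊆ (g n)ᶜ := fun x hx hx' => h2 ⟨x, hx, hx'⟩
    have hex : ∃ x ∈ U, ∃ y ∈ V, ¬ R n x y := by
      by_contra hcon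
      push Not at hcon
      obtain ⟨x0, hx0⟩ := hUn
      obtain ⟨y0, hy0⟩ := hVn
      obtain ⟨L0, -, hL0c, hx0L, hy0L, hL0g⟩ := hcon x0 hx0 y0 hy0
      obtain ⟨e, he⟩ := hgn n
      apply hD
      refine no_fat hI hA hAc ha hB hBc hb
        (compIn_closed (hgo n).isClosed_compl x0) (isPreconnected_connectedComponentIn (x := x0))
        hU ⟨x0, hx0⟩ hUO ?_ ((hgm n).2 he) (fun h => connectedComponentIn_subset _ _ h he)
      intro x hx
      obtain ⟨L, -, hLc, hxL, hyL, hLg⟩ := hcon x hx y0 hy0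
      exact (IsPreconnected.union y0 hyL hy0L hLc hL0c).subset_connectedComponentIn (Or.inr hx0L)
        (Set.union_subset hLg hL0g) (Or.inl hxL)
    obtain ⟨x, hx, y, hy, hxy⟩ := hex
    have : CompactSpace ((g n)ᶜ : Set X) := isCompact_iff_compactSpace.1 (hgo n).isClosed_compl.isCompact
    have hyn : (⟨y, hVg hy⟩ : ((g n)ᶜ : Set X)) ∉ connectedComponent ⟨x, hUg hx⟩ := by
      intro h
      apply hxy
      refine ⟨connectedComponentIn (g n)ᶜ x, compIn_closed (hgo n).isClosed_compl x,
        isPreconnected_connectedComponentIn, mem_connectedComponentIn (hUg hx), ?_,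
        connectedComponentIn_subset _ _⟩
      rw [connectedComponentIn_eq_image (hUg hx)]
      exact ⟨_, h, rfl⟩
    rw [connectedComponent_eq_iInter_isClopen, Set.mem_iInter] at hyn
    push Not at hyn
    obtain ⟨⟨Z, hZ, hxZ⟩, hyZ⟩ := hyn
    obtain ⟨G, hG, hGZ⟩ := isOpen_induced_iff.1 hZ.isOpen
    obtain ⟨G', hG', hGZ'⟩ := isOpen_induced_iff.1 hZ.compl.isOpen
    have mG : ∀ w (hw : w ∈ (g n)ᶜ), w ∈ G ↔ (⟨w, hw⟩ : ((g n)ᶜ : Set X)) ∈ Z := fun w hw => by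
      rw [← hGZ]; rfl
    have mG' : ∀ w (hw : w ∈ (g n)ᶜ), w ∈ G' ↔ (⟨w, hw⟩ : ((g n)ᶜ : Set X)) ∉ Z := fun w hw => by
      rw [← Set.mem_compl_iff, ← hGZ']; rfl
    refine ⟨U ∩ G, V ∩ G', hU.inter hG, hV.inter hG', ⟨x, hx, (mG x (hUg hx)).2 hxZ⟩,
      ⟨y, hy, (mG' y (hVg hy)).2 hyZ⟩, Set.inter_subset_left, Set.inter_subset_left, ?_⟩
    rintro x' ⟨-, hx'⟩ y' ⟨-, hy'⟩ ⟨L, hL, hLc, hxL, hyL, hLg⟩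
    obtain ⟨w, hw, hwG, hwG'⟩ := hLc G G' hG hG' (fun w hw => by
      by_cases h : (⟨w, hLg hw⟩ : ((g n)ᶜ : Set X)) ∈ Z
      · exact Or.inl ((mG w _).2 h)
      · exact Or.inr ((mG' w _).2 h)) ⟨x', hxL, hx'⟩ ⟨y', hyL, hy'⟩
    exact (mG' w (hLg hw)).1 hwG' ((mG w (hLg hw)).1 hwG)
  obtain ⟨f, hf⟩ := mycielski hO hOn hR
  refine ⟨f, fun x y hxy L hL hLc hLi hx hy => ?_⟩
  have hOL : (O ∩ Lᶜ).Nonempty := by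
    by_contra h
    have : O ⊆ L := fun w hw => by
      by_contra hw'; exact h ⟨w, hw, hw'⟩
    have h2 := interior_maximal this hO
    rw [hLi] at h2
    exact (hOn.mono h2).ne_empty rfl
  obtain ⟨C, hC, hCs⟩ := hbs _ (hO.inter hL.isOpen_compl) hOL
  have : C ∈ Set.range g := by rw [← hg]; exact ⟨hC, hCs.trans Set.inter_subset_left⟩
  obtain ⟨n, rfl⟩ := this
  exact hf x y hxy n ⟨L, hL, hLc, hx, hy, Set.subset_compl_comm.1 (hCs.trans Set.inter_subset_right)⟩

/-- Decompositions of `X` into two closed connected sets, containing `a` and `b`. -/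
def CutPair (a b : X) : Type :=
  {p : Set X × Set X // (IsClosed p.1 ∧ IsPreconnected p.1 ∧ a ∈ p.1) ∧
    (IsClosed p.2 ∧ IsPreconnected p.2 ∧ b ∈ p.2) ∧ p.1 ∪ p.2 = univ}

/-- The strict order on cut pairs. -/
def CutLt {a b : X} (p q : CutPair a b) : Prop :=
  p.1.1 ⊆ q.1.1 ∧ q.1.2 ⊆ p.1.2 ∧ p.1.1 ∪ q.1.2 ≠ univ

lemma CutLt.trans {a b : X} {p q r : CutPair a b} (h : CutLt p q) (h' : CutLt q r) : CutLt p r := by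
  refine ⟨h.1.trans h'.1, h'.2.1.trans h.2.1, fun he => h.2.2 ?_⟩
  exact Set.univ_subset_iff.1 (he.symm.subset.trans (Set.union_subset_union_right _ h'.2.1))

lemma CutLt.irrefl {a b : X} (p : CutPair a b) : ¬ CutLt p p := fun h => h.2.2 p.2.2.2

lemma cut_dense {a b : X} (hI : IrrBetween a b)
    (hD : ∀ A B : Set X, IsClosed A → IsPreconnected A → a ∈ A → IsClosed B → IsPreconnected B →
      b ∈ B → A ∪ B ≠ univ → Dec (closure (A ∪ B)ᶜ)) {p q : CutPair a b} (h : CutLt p q) :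
    ∃ z, CutLt p z ∧ CutLt z q := by
  obtain ⟨⟨A, A'⟩, ⟨hA, hAc, ha⟩, ⟨hA', hAc', hb'⟩, hu⟩ := p
  obtain ⟨⟨B', B⟩, ⟨hB', hBc', ha'⟩, ⟨hB, hBc, hb⟩, hu'⟩ := q
  obtain ⟨h1, h2, h3⟩ := h
  dsimp only at *
  obtain ⟨H, K, hH, hK, hHK, c1, c2, n1, n2⟩ := gap_insert hI hA hAc ha hB hBc hb h3
    (hD A B hA hAc ha hB hBc hb h3)
  have hcov : (A ∪ H) ∪ (B ∪ K) = univ := by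
    refine Set.eq_univ_of_forall fun x => ?_
    by_cases hx : x ∈ A ∪ B
    · rcases hx with h | h
      · exact Or.inl (Or.inl h)
      · exact Or.inr (Or.inl h)
    · have : x ∈ H ∪ K := by rw [hHK]; exact subset_closure hx
      rcases this with h | h
      · exact Or.inl (Or.inr h)
      · exact Or.inr (Or.inr h)
  have hMB' : H ∪ K ⊆ B' := by
    rw [hHK]
    refine closure_minimal (fun x hx => ?_) hB'
    have : x ∈ B' ∪ B := by rw [hu']; trivial
    rcases this with h | h
    · exact h
    · exact (hx (Or.inr h)).elim
  have hMA' : H ∪ K ⊆ A' := by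
    rw [hHK]
    refine closure_minimal (fun x hx => ?_) hA'
    have : x ∈ A ∪ A' := by rw [hu]; trivial
    rcases this with h | h
    · exact (hx (Or.inl h)).elim
    · exact h
  refine ⟨⟨(A ∪ H, B ∪ K), ⟨hA.union hH, c1, Or.inl ha⟩, ⟨hB.union hK, c2, Or.inl hb⟩, hcov⟩,
    ⟨Set.subset_union_left, Set.union_subset h2 (Set.subset_union_right.trans hMA'), n1⟩,
    ⟨Set.union_subset h1 (Set.subset_union_left.trans hMB'), Set.subset_union_left, n2⟩⟩

lemma cut_rat {a b : X} [Nontrivial X] (hI : IrrBetween a b)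
    (hD : ∀ A B : Set X, IsClosed A → IsPreconnected A → a ∈ A → IsClosed B → IsPreconnected B →
      b ∈ B → A ∪ B ≠ univ → Dec (closure (A ∪ B)ᶜ)) :
    ∃ e : ℚ → CutPair a b, ∀ s t, s < t → CutLt (e s) (e t) := by
  classical
  have hab : a ≠ b := by
    rintro rfl
    have := hI {a} isClosed_singleton isPreconnected_singleton rfl rfl
    obtain ⟨c, hc⟩ := exists_ne a
    have h2 : c ∈ ({a} : Set X) := by rw [this]; trivial
    exact hc h2
  have hab2 : ({a} : Set X) ∪ {b} ≠ univ := by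
    intro h
    obtain ⟨x, hx, hx'⟩ := cover_meet (isClosed_singleton (x := a)) (isClosed_singleton (x := b)) h
      ⟨a, rfl⟩ ⟨b, rfl⟩
    exact hab (hx.symm.trans hx')
  let p0 : CutPair a b := ⟨({a}, univ), ⟨isClosed_singleton, isPreconnected_singleton, rfl⟩,
    ⟨isClosed_univ, isPreconnected_univ, trivial⟩, Set.union_univ _⟩
  let p1 : CutPair a b := ⟨(univ, {b}), ⟨isClosed_univ, isPreconnected_univ, trivial⟩,
    ⟨isClosed_singleton, isPreconnected_singleton, rfl⟩, Set.univ_union _⟩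
  have h01 : CutLt p0 p1 := ⟨Set.subset_univ _, Set.subset_univ _, hab2⟩
  have hch : IsChain CutLt ({p0, p1} : Set (CutPair a b)) := IsChain.pair h01
  obtain ⟨M, hM, hMs⟩ := hch.exists_maxChain
  let r : M → M → Prop := fun x y => CutLt x.1 y.1
  have tri : ∀ x ∈ M, ∀ y ∈ M, CutLt x y ∨ x = y ∨ CutLt y x := by
    intro x hx y hy
    by_cases h : x = y
    · exact Or.inr (Or.inl h)
    · rcases hM.1 hx hy h with h' | h'
      · exact Or.inl h'
      · exact Or.inr (Or.inr h')
  let o : LinearOrder M :=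
    { le := fun x y => x = y ∨ CutLt x.1 y.1
      lt := fun x y => CutLt x.1 y.1
      le_refl := fun x => Or.inl rfl
      le_trans := by
        rintro x y z (rfl | h) (rfl | h')
        · exact Or.inl rfl
        · exact Or.inr h'
        · exact Or.inr h
        · exact Or.inr (h.trans h')
      lt_iff_le_not_ge := by
        intro x y
        constructor
        · intro h
          refine ⟨Or.inr h, ?_⟩
          rintro (rfl | h')
          · exact CutLt.irrefl _ h
          · exact CutLt.irrefl _ (h.trans h')
        · rintro ⟨rfl | h, h'⟩
          · exact (h' (Or.inl rfl)).elim
          · exact h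
      le_antisymm := by
        rintro x y (rfl | h) (h' | h')
        · rfl
        · rfl
        · exact h'.symm
        · exact (CutLt.irrefl _ (h.trans h')).elim
      le_total := by
        intro x y
        rcases tri x.1 x.2 y.1 y.2 with h | h | h
        · exact Or.inl (Or.inr h)
        · exact Or.inl (Or.inl (Subtype.ext h))
        · exact Or.inr (Or.inr h)
      toDecidableLE := Classical.decRel _ }
  have hden : DenselyOrdered M := by
    refine ⟨fun x y hxy => ?_⟩
    by_contra hcon
    push Not at hcon
    obtain ⟨z, hz1, hz2⟩ := cut_dense hI hD (show CutLt x.1 y.1 from hxy)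
    have hzc : ∀ c ∈ M, CutLt z c ∨ CutLt c z := by
      intro c hc
      rcases tri x.1 x.2 c hc with h | h | h
      · rcases tri c hc y.1 y.2 with h' | h' | h'
        · exact absurd (show (⟨c, hc⟩ : M) < y from h') (not_lt.2 (hcon ⟨c, hc⟩ h))
        · left; rw [h']; exact hz2
        · left; exact hz2.trans h'
      · right; rw [← h]; exact hz1
      · right; exact h.trans hz1
    have hch2 : IsChain CutLt (insert z M) := hM.1.insert fun c hc _ => hzc c hc
    have hzM : z ∈ M := by
      rw [hM.2 hch2 (Set.subset_insert _ _)]; exact Set.mem_insert _ _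
    exact absurd (show (⟨z, hzM⟩ : M) < y from hz2) (not_lt.2 (hcon ⟨z, hzM⟩ hz1))
  have hnt : Nontrivial M := ⟨⟨p0, hMs (by simp)⟩, ⟨p1, hMs (by simp)⟩, fun h => by
    have h2 : p0 = p1 := congrArg Subtype.val h
    rw [h2] at h01
    exact CutLt.irrefl _ h01⟩
  obtain ⟨e⟩ := Order.embedding_from_countable_to_dense ℚ M
  exact ⟨fun q => (e q).1, fun s t h => (e.lt_iff_lt.2 h : e s < e t)⟩

lemma dense_case {a b : X} [Nontrivial X] (hI : IrrBetween a b)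
    (hD : ∀ A B : Set X, IsClosed A → IsPreconnected A → a ∈ A → IsClosed B → IsPreconnected B →
      b ∈ B → A ∪ B ≠ univ → Dec (closure (A ∪ B)ᶜ)) :
    ∃ f : ℝ → X, ∀ x y, x ≠ y → ∀ L, IsClosed L → IsPreconnected L → interior L = ∅ →
      f x ∈ L → f y ∈ L → False := by
  obtain ⟨e, he⟩ := cut_rat hI hD
  have hmA : ∀ s t, s ≤ t → (e s).1.1 ⊆ (e t).1.1 := fun s t h => by
    rcases h.eq_or_lt with rfl | h
    · exact subset_rfl
    · exact (he s t h).1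
  have hmB : ∀ s t, s ≤ t → (e t).1.2 ⊆ (e s).1.2 := fun s t h => by
    rcases h.eq_or_lt with rfl | h
    · exact subset_rfl
    · exact (he s t h).2.1
  have hex : ∀ r : ℝ, ∃ p : X, (∀ t : ℚ, r < t → p ∈ (e t).1.1) ∧ ∀ s : ℚ, (s : ℝ) < r → p ∈ (e s).1.2 := by
    intro r
    let ι := {q : ℚ × ℚ // (q.1 : ℝ) < r ∧ r < q.2}
    obtain ⟨s0, hs0⟩ := exists_rat_lt r
    obtain ⟨t0, ht0⟩ := exists_rat_gt r
    have : Nonempty ι := ⟨⟨(s0, t0), hs0, ht0⟩⟩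
    have hcl : ∀ i : ι, IsClosed ((e i.1.2).1.1 ∩ (e i.1.1).1.2) := fun i =>
      (e i.1.2).2.1.1.inter (e i.1.1).2.2.1.1
    have := IsCompact.nonempty_iInter_of_directed_nonempty_isCompact_isClosed
      (fun i : ι => (e i.1.2).1.1 ∩ (e i.1.1).1.2) ?_ ?_ (fun i => (hcl i).isCompact) hcl
    · obtain ⟨p, hp⟩ := this
      rw [Set.mem_iInter] at hp
      exact ⟨p, fun t ht => (hp ⟨(s0, t), hs0, ht⟩).1, fun s hs => (hp ⟨(s, t0), hs, ht0⟩).2⟩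
    · rintro ⟨⟨s, t⟩, hs, ht⟩ ⟨⟨s', t'⟩, hs', ht'⟩
      refine ⟨⟨(max s s', min t t'), ?_, ?_⟩, ?_, ?_⟩
      · dsimp only at *; push_cast; exact max_lt hs hs'
      · dsimp only at *; push_cast; exact lt_min ht ht'
      · exact Set.inter_subset_inter (hmA _ _ (min_le_left _ _)) (hmB _ _ (le_max_left _ _))
      · exact Set.inter_subset_inter (hmA _ _ (min_le_right _ _)) (hmB _ _ (le_max_right _ _))
    · rintro ⟨⟨s, t⟩, hs, ht⟩
      have hst : s ≤ t := by exact_mod_cast (hs.trans ht).le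
      refine cover_meet (e t).2.1.1 (e s).2.2.1.1 ?_ ⟨a, (e t).2.1.2.2⟩ ⟨b, (e s).2.2.1.2.2⟩
      exact Set.univ_subset_iff.1
        ((e t).2.2.2.symm.subset.trans (Set.union_subset_union_right _ (hmB s t hst)))
  choose f hfA hfB using hex
  have key : ∀ x y : ℝ, x < y → ∀ L, IsClosed L → IsPreconnected L → interior L = ∅ →
      f x ∈ L → f y ∈ L → False := by
    intro x y hxy L hL hLc hLi hx hy
    obtain ⟨t, hxt, hty⟩ := exists_rat_btwn hxy
    obtain ⟨s, hts, hsy⟩ := exists_rat_btwn hty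
    have hts' : t < s := by exact_mod_cast hts
    have hne := (he t s hts').2.2
    have h1 := hI (((e t).1.1 ∪ L) ∪ (e s).1.2) (((e t).2.1.1.union hL).union (e s).2.2.1.1)
      (IsPreconnected.union (f y) (Or.inr hy) (hfB y s hsy)
        (IsPreconnected.union (f x) (hfA x t hxt) hx (e t).2.1.2.1 hLc) (e s).2.2.1.2.1)
      (Or.inl (Or.inl (e t).2.1.2.2)) (Or.inr (e s).2.2.1.2.2)
    have h2 : ((e t).1.1 ∪ (e s).1.2)ᶜ ⊆ L := by
      intro w hw
      have : w ∈ ((e t).1.1 ∪ L) ∪ (e s).1.2 := by rw [h1]; trivial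
      rcases this with (h | h) | h
      · exact (hw (Or.inl h)).elim
      · exact h
      · exact (hw (Or.inr h)).elim
    have h3 := interior_maximal h2 ((e t).2.1.1.union (e s).2.2.1.1).isOpen_compl
    rw [hLi] at h3
    exact ((Set.nonempty_compl.2 hne).mono h3).ne_empty rfl
  refine ⟨f, fun x y hxy L hL hLc hLi hx hy => ?_⟩
  rcases lt_or_gt_of_ne hxy with h | h
  · exact key x y h L hL hLc hLi hx hy
  · exact key y x h L hL hLc hLi hy hx

lemma continuum_le_of {T : Type} [Nontrivial X] (hT : Cardinal.mk T = Cardinal.continuum) (f : T → X)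
    (hf : ∀ x y, x ≠ y → ∀ L, IsClosed L → IsPreconnected L → interior L = ∅ →
      f x ∈ L → f y ∈ L → False) :
    Cardinal.continuum ≤ Cardinal.mk {S : Set X | ∃ x : X, S = MeagerComposant X x} := by
  rw [← hT]
  refine Cardinal.mk_le_of_injective (f := fun t => ⟨MeagerComposant X (f t), f t, rfl⟩) ?_
  intro s t hst
  by_contra hne
  have h1 : MeagerComposant X (f s) = MeagerComposant X (f t) := congrArg Subtype.val hst
  have h2 : f t ∈ MeagerComposant X (f t) := by
    refine ⟨{f t}, ⟨isCompact_singleton, isConnected_singleton, ?_, rfl⟩, rfl⟩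
    rw [IsNowhereDense, closure_singleton]
    by_contra h
    rw [← ne_eq, ← Set.nonempty_iff_ne_empty] at h
    obtain ⟨y, hy⟩ := h
    have hy' : y ∈ ({f t} : Set X) := interior_subset hy
    rw [Set.mem_singleton_iff] at hy'
    rw [hy'] at hy
    have hio : interior ({f t} : Set X) = {f t} :=
      Set.Subset.antisymm interior_subset (Set.singleton_subset_iff.2 hy)
    have hop : IsOpen ({f t} : Set X) := by rw [← hio]; exact isOpen_interior
    rcases isClopen_iff.1 (⟨isClosed_singleton, hop⟩ : IsClopen ({f t} : Set X)) with h | h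
    · exact Set.singleton_ne_empty _ h
    · obtain ⟨c, hc⟩ := exists_ne (f t)
      have h2 : c ∈ ({f t} : Set X) := by rw [h]; trivial
      exact hc h2
  rw [← h1] at h2
  obtain ⟨L, ⟨hLc, hLcn, hLn, hs⟩, ht⟩ := h2
  have hcl := hLc.isClosed
  rw [IsNowhereDense, hcl.closure_eq] at hLn
  exact hf s t hne L hcl hLcn.isPreconnected hLn hs ht

lemma card_le_continuum_of_compact : Cardinal.mk X ≤ Cardinal.continuum := by
  obtain ⟨u, hu⟩ := TopologicalSpace.exists_dense_seq X
  have hinj : Function.Injective (fun (x : X) (n : ℕ) => dist x (u n)) := by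
    intro x y h
    by_contra hne
    have hpos : 0 < dist x y := dist_pos.2 hne
    obtain ⟨n, hn⟩ := hu.exists_dist_lt x (half_pos hpos)
    have h1 : dist x (u n) = dist y (u n) := congrFun h n
    have h2 := dist_triangle x (u n) y
    rw [dist_comm (u n) y] at h2
    linarith
  refine (Cardinal.mk_le_of_injective hinj).trans ?_
  simp [Cardinal.mk_real]

end Final

/-- Every (nondegenerate) chainable continuum has exactly `2 ^ ℵ₀` meager composants. -/
theorem card_meagerComposants_chainable (X : Type) [MetricSpace X] [CompactSpace X] [ConnectedSpace X] [Nonempty X] [Nontrivial X]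
    (hX : Chainable X) :
    Cardinal.mk {S : Set X | ∃ x : X, S = MeagerComposant X x} = Cardinal.continuum := by
  apply le_antisymm
  · have h1 : Cardinal.mk {S : Set X | ∃ x : X, S = MeagerComposant X x} ≤ Cardinal.mk X := by
      refine Cardinal.mk_le_of_surjective (f := fun x : X => ⟨MeagerComposant X x, x, rfl⟩) ?_
      rintro ⟨S, x, rfl⟩
      exact ⟨x, rfl⟩
    exact h1.trans card_le_continuum_of_compact
  · obtain ⟨a, b, hI⟩ := irreducible_exists hX
    by_cases hD : ∀ A B : Set X, IsClosed A → IsPreconnected A → a ∈ A → IsClosed B →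
        IsPreconnected B → b ∈ B → A ∪ B ≠ univ → Dec (closure (A ∪ B)ᶜ)
    · obtain ⟨f, hf⟩ := dense_case hI hD
      exact continuum_le_of Cardinal.mk_real f hf
    · push Not at hD
      obtain ⟨A, B, hA, hAc, ha, hB, hBc, hb, hne, hD⟩ := hD
      obtain ⟨f, hf⟩ := gap_case hI hA hAc ha hB hBc hb hne hD
      exact continuum_le_of (by simp) f hf
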